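/- Factorization of the wave operator along hyperbolic rays: Let v be a smooth function on an open subset of {(t,x) ∈ ℝ×ℝ³ : t > |x|}, and define ∂̄_s v = (s/t)∂_t v with s = √(t² − |x|²), ∂̄_a v = (x^a/t)∂_t v + ∂_a v, and ℒw = ∂̄_s w + Σ_a (x^a/s) ∂̄_a w. Then pointwise: □v = s^{−3/2} ℒ(ℒ(s^{3/2} v)) − Σ_{a,b} (x^a x^b/s²) ∂̄_a(∂̄_b v) − Σ_a ∂̄_a(∂̄_a v) − Σ_a (3x^a/s²) ∂̄_a v − (3/(4s²)) v. -/

import Mathlib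

noncomputable section

/-- Spatial radius `r = |x|` of a space-time point `p = (t,x)`. -/
def rad (p : Fin 4 → ℝ) : ℝ := Real.sqrt (∑ a : Fin 3, (p a.succ) ^ 2)

/-- Partial derivative in the `i`-th coordinate direction (`0` is time). -/
def pd (i : Fin 4) (u : (Fin 4 → ℝ) → ℝ) : (Fin 4 → ℝ) → ℝ :=
  fun p => fderiv ℝ u p (Pi.single i 1)

/-- The flat wave operator `□u = ∂_t∂_t u - Σ_a ∂_a∂_a u`. -/
def box (u : (Fin 4 → ℝ) → ℝ) : (Fin 4 → ℝ) → ℝ :=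
  fun p => pd 0 (pd 0 u) p - ∑ a : Fin 3, pd a.succ (pd a.succ u) p

/-- The hyperboloidal time `s = √(t² - r²)`. -/
def sfun (p : Fin 4 → ℝ) : ℝ := Real.sqrt ((p 0) ^ 2 - (rad p) ^ 2)

/-- `∂̄_s v = (s/t) ∂_t v`, the `s`-coordinate vector field of hyperbolic coordinates. -/
def dbs (v : (Fin 4 → ℝ) → ℝ) : (Fin 4 → ℝ) → ℝ :=
  fun p => (sfun p / p 0) * pd 0 v p

/-- `∂̄_a v = (x^a/t) ∂_t v + ∂_a v`, the spatial vector fields of hyperbolic coordinates. -/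
def dba (a : Fin 3) (v : (Fin 4 → ℝ) → ℝ) : (Fin 4 → ℝ) → ℝ :=
  fun p => (p a.succ / p 0) * pd 0 v p + pd a.succ v p

/-- `ℒ w = ∂̄_s w + Σ_a (x^a/s) ∂̄_a w`. -/
def Lcal (w : (Fin 4 → ℝ) → ℝ) : (Fin 4 → ℝ) → ℝ :=
  fun p => dbs w p + ∑ a : Fin 3, (p a.succ / sfun p) * dba a w p

/-- The function `(t,x) ↦ (t² - |x|²)^{3/4} v(t,x)`, i.e. `s^{3/2} v`. -/
def mul32 (v : (Fin 4 → ℝ) → ℝ) : (Fin 4 → ℝ) → ℝ :=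
  fun p => ((p 0) ^ 2 - (rad p) ^ 2) ^ ((3:ℝ)/4) * v p

/-- The scaling vector field `t ∂_t + Σ_a x^a ∂_a`. -/
def scaling (u : (Fin 4 → ℝ) → ℝ) : (Fin 4 → ℝ) → ℝ :=
  fun p => ∑ i : Fin 4, p i * pd i u p

lemma pd_congr {u w : (Fin 4 → ℝ) → ℝ} {p : Fin 4 → ℝ} (h : u =ᶠ[nhds p] w) (i : Fin 4) :
    pd i u p = pd i w p := by
  unfold pd
  rw [h.fderiv_eq]

lemma pd_add {u w : (Fin 4 → ℝ) → ℝ} {p : Fin 4 → ℝ} (hu : DifferentiableAt ℝ u p)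
    (hw : DifferentiableAt ℝ w p) (i : Fin 4) :
    pd i (fun q => u q + w q) p = pd i u p + pd i w p := by
  unfold pd
  rw [fderiv_fun_add hu hw]
  rfl

lemma pd_mul {u w : (Fin 4 → ℝ) → ℝ} {p : Fin 4 → ℝ} (hu : DifferentiableAt ℝ u p)
    (hw : DifferentiableAt ℝ w p) (i : Fin 4) :
    pd i (fun q => u q * w q) p = u p * pd i w p + w p * pd i u p := by
  unfold pd
  rw [fderiv_fun_mul hu hw]
  rfl

lemma pd_const_mul {u : (Fin 4 → ℝ) → ℝ} {p : Fin 4 → ℝ} (hu : DifferentiableAt ℝ u p)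
    (c : ℝ) (i : Fin 4) : pd i (fun q => c * u q) p = c * pd i u p := by
  unfold pd
  rw [fderiv_const_mul hu c]
  rfl

lemma pd_coord (i j : Fin 4) (p : Fin 4 → ℝ) :
    pd i (fun q => q j) p = if j = i then 1 else 0 := by
  have h : HasFDerivAt (fun q : Fin 4 → ℝ => q j)
      (ContinuousLinearMap.proj (R := ℝ) (φ := fun _ : Fin 4 => ℝ) j) p :=
    (ContinuousLinearMap.proj (R := ℝ) (φ := fun _ : Fin 4 => ℝ) j).hasFDerivAt
  simp [pd, h.fderiv, Pi.single_apply]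

lemma pd_coord_div_time {p : Fin 4 → ℝ} (hp : p 0 ≠ 0) (i j : Fin 4) :
    pd i (fun q => q j / q 0) p
      = (if j = i then 1 else 0) / p 0 - p j / p 0 ^ 2 * (if 0 = i then 1 else 0) := by
  have hd : ∀ k, DifferentiableAt ℝ (fun q : Fin 4 → ℝ => q k) p := fun k => by fun_prop
  have hdiv : DifferentiableAt ℝ (fun q : Fin 4 → ℝ => q j / q 0) p := by
    fun_prop (disch := exact hp)
  have hne : ∀ᶠ q : Fin 4 → ℝ in nhds p, q 0 ≠ 0 :=
    (hd 0).continuousAt.eventually_ne hp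
  have h := pd_mul hdiv (hd 0) i
  have h' : pd i (fun q => q j / q 0 * q 0) p = pd i (fun q => q j) p := by
    apply pd_congr
    filter_upwards [hne] with q hq
    exact div_mul_cancel₀ _ hq
  rw [h', pd_coord, pd_coord] at h
  rw [h]
  field_simp
  ring

lemma rad_sq (p : Fin 4 → ℝ) : rad p ^ 2 = p 1 ^ 2 + p 2 ^ 2 + p 3 ^ 2 := by
  unfold rad
  rw [Real.sq_sqrt (Finset.sum_nonneg fun a _ => sq_nonneg _), Fin.sum_univ_three]
  rfl

lemma time_pos {p : Fin 4 → ℝ} (hp : rad p < p 0) : 0 < p 0 :=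
  (Real.sqrt_nonneg _).trans_lt hp

lemma interval_pos {p : Fin 4 → ℝ} (hp : rad p < p 0) : 0 < p 0 ^ 2 - rad p ^ 2 := by
  have h : 0 ≤ rad p := Real.sqrt_nonneg _
  nlinarith

lemma sfun_pos {p : Fin 4 → ℝ} (hp : rad p < p 0) : 0 < sfun p :=
  Real.sqrt_pos.2 (interval_pos hp)

lemma sfun_sq {p : Fin 4 → ℝ} (hp : rad p < p 0) :
    sfun p ^ 2 = p 0 ^ 2 - (p 1 ^ 2 + p 2 ^ 2 + p 3 ^ 2) := by
  rw [sfun, Real.sq_sqrt (interval_pos hp).le, rad_sq]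

lemma interval_rpow {p : Fin 4 → ℝ} (hp : rad p < p 0) (c : ℝ) :
    (p 0 ^ 2 - rad p ^ 2) ^ c = sfun p ^ (2 * c) := by
  have h : p 0 ^ 2 - rad p ^ 2 = sfun p ^ (2 : ℝ) := by
    rw [Real.rpow_two, sfun, Real.sq_sqrt (interval_pos hp).le]
  rw [h, ← Real.rpow_mul (sfun_pos hp).le]

lemma Lcal_eq_scaling_div (w : (Fin 4 → ℝ) → ℝ) {p : Fin 4 → ℝ} (hp : rad p < p 0) :
    Lcal w p = scaling w p / sfun p := by
  have ht := (time_pos hp).ne'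
  have hs := (sfun_pos hp).ne'
  have hs2 := sfun_sq hp
  simp only [Lcal, dbs, dba, scaling, Fin.sum_univ_three, Fin.sum_univ_four]
  simp only [show (0 : Fin 3).succ = (1 : Fin 4) from rfl,
    show (1 : Fin 3).succ = (2 : Fin 4) from rfl, show (2 : Fin 3).succ = (3 : Fin 4) from rfl]
  field_simp
  rw [hs2]
  ring

lemma scaling_congr {u w : (Fin 4 → ℝ) → ℝ} {p : Fin 4 → ℝ} (h : u =ᶠ[nhds p] w) :
    scaling u p = scaling w p := by
  simp only [scaling, pd_congr h]

lemma scaling_add {u w : (Fin 4 → ℝ) → ℝ} {p : Fin 4 → ℝ} (hu : DifferentiableAt ℝ u p)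
    (hw : DifferentiableAt ℝ w p) :
    scaling (fun q => u q + w q) p = scaling u p + scaling w p := by
  simp only [scaling, pd_add hu hw, mul_add, Finset.sum_add_distrib]

lemma scaling_const_mul {u : (Fin 4 → ℝ) → ℝ} {p : Fin 4 → ℝ} (hu : DifferentiableAt ℝ u p)
    (c : ℝ) : scaling (fun q => c * u q) p = c * scaling u p := by
  simp only [scaling, pd_const_mul hu, Finset.mul_sum, mul_left_comm]

lemma scaling_mul {u w : (Fin 4 → ℝ) → ℝ} {p : Fin 4 → ℝ} (hu : DifferentiableAt ℝ u p)
    (hw : DifferentiableAt ℝ w p) :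
    scaling (fun q => u q * w q) p = u p * scaling w p + w p * scaling u p := by
  simp only [scaling, pd_mul hu hw, Finset.mul_sum, ← Finset.sum_add_distrib]
  exact Finset.sum_congr rfl fun i _ => by ring

lemma scaling_scaling {v : (Fin 4 → ℝ) → ℝ} {p : Fin 4 → ℝ}
    (hv : ∀ i, DifferentiableAt ℝ (pd i v) p) :
    scaling (scaling v) p
      = ∑ i : Fin 4, p i * (pd i v p + ∑ j : Fin 4, p j * pd i (pd j v) p) := by
  have hd : ∀ k, DifferentiableAt ℝ (fun q : Fin 4 → ℝ => q k) p := fun k => by fun_prop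
  have hm : ∀ k, DifferentiableAt ℝ (fun q => q k * pd k v q) p := fun k => (hd k).mul (hv k)
  have key : ∀ i, pd i (scaling v) p = pd i v p + ∑ j : Fin 4, p j * pd i (pd j v) p := by
    intro i
    have : pd i (scaling v) p = ∑ j : Fin 4, pd i (fun q => q j * pd j v q) p := by
      change fderiv ℝ (fun q => ∑ j : Fin 4, q j * pd j v q) p (Pi.single i 1) = _
      rw [fderiv_fun_sum fun k _ => hm k, sum_apply]
      rfl
    rw [this]
    simp only [pd_mul (hd _) (hv _), pd_coord, Finset.sum_add_distrib]
    simp [add_comm]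
  conv_lhs => rw [scaling]
  simp only [key]

lemma hasFDerivAt_interval (p : Fin 4 → ℝ) :
    HasFDerivAt (fun q : Fin 4 → ℝ => q 0 ^ 2 - rad q ^ 2)
      ((2 * p 0) • ContinuousLinearMap.proj (R := ℝ) (φ := fun _ : Fin 4 => ℝ) 0
        - ((2 * p 1) • ContinuousLinearMap.proj (R := ℝ) (φ := fun _ : Fin 4 => ℝ) 1
        + (2 * p 2) • ContinuousLinearMap.proj (R := ℝ) (φ := fun _ : Fin 4 => ℝ) 2
        + (2 * p 3) • ContinuousLinearMap.proj (R := ℝ) (φ := fun _ : Fin 4 => ℝ) 3)) p := by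
  have h : ∀ k, HasFDerivAt (fun q : Fin 4 → ℝ => q k ^ 2)
      ((2 * p k) • ContinuousLinearMap.proj (R := ℝ) (φ := fun _ : Fin 4 => ℝ) k) p := by
    intro k
    simpa using
      (ContinuousLinearMap.proj (R := ℝ) (φ := fun _ : Fin 4 => ℝ) k).hasFDerivAt (x := p) |>.pow 2
  simp only [rad_sq]
  exact (h 0).sub (((h 1).add (h 2)).add (h 3))

lemma differentiableAt_interval_rpow {p : Fin 4 → ℝ} (hp : rad p < p 0) (c : ℝ) :
    DifferentiableAt ℝ (fun q : Fin 4 → ℝ => (q 0 ^ 2 - rad q ^ 2) ^ c) p :=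
  ((hasFDerivAt_interval p).rpow_const (Or.inl (interval_pos hp).ne')).differentiableAt

lemma scaling_interval_rpow {p : Fin 4 → ℝ} (hp : rad p < p 0) (c : ℝ) :
    scaling (fun q => (q 0 ^ 2 - rad q ^ 2) ^ c) p
      = 2 * c * (p 0 ^ 2 - rad p ^ 2) ^ c := by
  have hpos := interval_pos hp
  have h := ((hasFDerivAt_interval p).rpow_const (p := c) (Or.inl hpos.ne')).fderiv
  have hc : (p 0 ^ 2 - rad p ^ 2) ^ c
      = (p 0 ^ 2 - rad p ^ 2) ^ (c - 1) * (p 0 ^ 2 - rad p ^ 2) := by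
    rw [← Real.rpow_add_one hpos.ne', sub_add_cancel]
  rw [hc]
  simp only [scaling, pd, h, Fin.sum_univ_four]
  simp
  rw [rad_sq]
  ring

lemma scaling_interval_rpow_mul {w : (Fin 4 → ℝ) → ℝ} {p : Fin 4 → ℝ} (hp : rad p < p 0)
    (hw : DifferentiableAt ℝ w p) (c : ℝ) :
    scaling (fun q => (q 0 ^ 2 - rad q ^ 2) ^ c * w q) p
      = (p 0 ^ 2 - rad p ^ 2) ^ c * (2 * c * w p + scaling w p) := by
  rw [scaling_mul (differentiableAt_interval_rpow hp c) hw, scaling_interval_rpow hp]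
  ring

lemma contDiffAt_pd {v : (Fin 4 → ℝ) → ℝ} {p : Fin 4 → ℝ}
    (hv : ContDiffAt ℝ (⊤ : ℕ∞) v p) (i : Fin 4) : ContDiffAt ℝ (⊤ : ℕ∞) (pd i v) p :=
  (hv.fderiv_right (m := ((⊤ : ℕ∞) : WithTop ℕ∞)) (by simp)).clm_apply contDiffAt_const

lemma pd_comm {v : (Fin 4 → ℝ) → ℝ} {p : Fin 4 → ℝ}
    (hv : ContDiffAt ℝ (⊤ : ℕ∞) v p) (i j : Fin 4) : pd i (pd j v) p = pd j (pd i v) p := by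
  have two_le : (2 : WithTop ℕ∞) ≤ ((⊤ : ℕ∞) : WithTop ℕ∞) :=
    WithTop.coe_le_coe.2 (le_top : (2 : ℕ∞) ≤ ⊤)
  have hs : IsSymmSndFDerivAt ℝ v p := hv.isSymmSndFDerivAt (by
    rw [minSmoothness_of_isRCLikeNormedField]
    exact two_le)
  have hd : DifferentiableAt ℝ (fderiv ℝ v) p :=
    (hv.fderiv_right (m := 1) (one_add_one_eq_two.trans_le two_le)).differentiableAt (by simp)
  have key : ∀ i j, pd i (pd j v) p
      = fderiv ℝ (fderiv ℝ v) p (Pi.single i 1) (Pi.single j 1) := by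
    intro i j
    change fderiv ℝ (fun q => fderiv ℝ v q (Pi.single j 1)) p (Pi.single i 1) = _
    rw [fderiv_clm_apply hd (differentiableAt_const _)]
    simp
  rw [key, key]
  exact hs.eq _ _

lemma pd_dba {v : (Fin 4 → ℝ) → ℝ} {p : Fin 4 → ℝ} (hp : p 0 ≠ 0)
    (hv : ∀ i, DifferentiableAt ℝ (pd i v) p) (i : Fin 4) (b : Fin 3) :
    pd i (dba b v) p
      = p b.succ / p 0 * pd i (pd 0 v) p
        + pd 0 v p * ((if b.succ = i then 1 else 0) / p 0
          - p b.succ / p 0 ^ 2 * (if 0 = i then 1 else 0))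
        + pd i (pd b.succ v) p := by
  have hdiv : DifferentiableAt ℝ (fun q : Fin 4 → ℝ => q b.succ / q 0) p := by
    fun_prop (disch := exact hp)
  change pd i (fun q => q b.succ / q 0 * pd 0 v q + pd b.succ v q) p = _
  have hmul : DifferentiableAt ℝ (fun q => q b.succ / q 0 * pd 0 v q) p := hdiv.mul (hv 0)
  rw [pd_add hmul (hv _), pd_mul hdiv (hv 0), pd_coord_div_time hp]

lemma Lcal_Lcal_mul32 {v : (Fin 4 → ℝ) → ℝ} {p : Fin 4 → ℝ} (hp : rad p < p 0)
    (hmem : ∀ᶠ q in nhds p, rad q < q 0) (hv : ContDiffAt ℝ (⊤ : ℕ∞) v p)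
    (hdiff : ∀ᶠ q in nhds p, DifferentiableAt ℝ v q) :
    sfun p ^ (-(3 : ℝ) / 2) * Lcal (Lcal (mul32 v)) p
      = (3 / 4 * v p + 2 * scaling v p + scaling (scaling v) p) / sfun p ^ 2 := by
  have hs := sfun_pos hp
  have h1 : Lcal (mul32 v) =ᶠ[nhds p]
      fun q => (q 0 ^ 2 - rad q ^ 2) ^ ((1 : ℝ) / 4) * (3 / 2 * v q + scaling v q) := by
    filter_upwards [hmem, hdiff] with q hq hvq
    rw [Lcal_eq_scaling_div _ hq]
    unfold mul32
    rw [scaling_interval_rpow_mul hq hvq, interval_rpow hq, interval_rpow hq,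
      show (2 * (3 / 4) : ℝ) = 2 * (1 / 4) + 1 by norm_num, Real.rpow_add_one (sfun_pos hq).ne']
    have := (sfun_pos hq).ne'
    field_simp
    ring
  have hv0 : DifferentiableAt ℝ v p := hv.differentiableAt (by simp)
  have hS : DifferentiableAt ℝ (scaling v) p := by
    have : ∀ i, DifferentiableAt ℝ (pd i v) p := fun i =>
      (contDiffAt_pd hv i).differentiableAt (by simp)
    unfold scaling
    fun_prop
  have hw : DifferentiableAt ℝ (fun q => 3 / 2 * v q + scaling v q) p := (hv0.const_mul _).add hS
  rw [Lcal_eq_scaling_div _ hp, scaling_congr h1, scaling_interval_rpow_mul hp hw,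
    scaling_add (hv0.const_mul _) hS, scaling_const_mul hv0, interval_rpow hp]
  have hpow : sfun p ^ (-(3 : ℝ) / 2) * sfun p ^ (2 * (1 / 4) : ℝ) = (sfun p)⁻¹ := by
    rw [← Real.rpow_add hs, ← Real.rpow_neg_one]
    norm_num
  calc _ = (sfun p ^ (-(3 : ℝ) / 2) * sfun p ^ (2 * (1 / 4) : ℝ))
        * (3 / 4 * v p + 2 * scaling v p + scaling (scaling v) p) / sfun p := by ring
    _ = _ := by
      rw [hpow]
      field_simp

/-- Factorization of the wave operator along hyperbolic rays. -/
theorem stmt_8 (U : Set (Fin 4 → ℝ)) (hU : IsOpen U)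
    (hUsub : ∀ p ∈ U, rad p < p 0)
    (v : (Fin 4 → ℝ) → ℝ) (hv : ContDiffOn ℝ (⊤ : ℕ∞) v U) :
    ∀ p ∈ U,
      box v p
        = (sfun p) ^ (-(3:ℝ)/2) * Lcal (Lcal (mul32 v)) p
          - (∑ a : Fin 3, ∑ b : Fin 3,
              (p a.succ * p b.succ / (sfun p) ^ 2) * dba a (dba b v) p)
          - (∑ a : Fin 3, dba a (dba a v) p)
          - (∑ a : Fin 3, (3 * p a.succ / (sfun p) ^ 2) * dba a v p)
          - (3 / (4 * (sfun p) ^ 2)) * v p := by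
  intro p hpU
  have hp := hUsub p hpU
  have hnhds : U ∈ nhds p := hU.mem_nhds hpU
  have hvp : ContDiffAt ℝ (⊤ : ℕ∞) v p := hv.contDiffAt hnhds
  have hmem : ∀ᶠ q in nhds p, rad q < q 0 := by
    filter_upwards [hnhds] with q hq using hUsub q hq
  have hdiff : ∀ᶠ q in nhds p, DifferentiableAt ℝ v q := by
    filter_upwards [hnhds] with q hq
    exact (hv.contDiffAt (hU.mem_nhds hq)).differentiableAt (by simp)
  have hpd : ∀ i, DifferentiableAt ℝ (pd i v) p := fun i =>
    (contDiffAt_pd hvp i).differentiableAt (by simp)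
  have ht := (time_pos hp).ne'
  rw [Lcal_Lcal_mul32 hp hmem hvp hdiff, scaling_scaling hpd]
  simp only [pd_dba ht hpd, box, scaling, dba, Fin.sum_univ_three, Fin.sum_univ_four]
  simp only [show (0 : Fin 3).succ = (1 : Fin 4) from rfl,
    show (1 : Fin 3).succ = (2 : Fin 4) from rfl, show (2 : Fin 3).succ = (3 : Fin 4) from rfl]
  rw [pd_comm hvp 1 0, pd_comm hvp 2 0, pd_comm hvp 3 0, pd_comm hvp 2 1, pd_comm hvp 3 1,
    pd_comm hvp 3 2]
  have hs := (sfun_pos hp).ne'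
  have hs2 := sfun_sq hp
  have hQ : p 0 ^ 2 - (p 1 ^ 2 + p 2 ^ 2 + p 3 ^ 2) ≠ 0 := hs2 ▸ pow_ne_zero 2 hs
  rw [hs2]
  simp
  field_simp
  ring
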